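/- arXiv:math/0401285 — 2 statements merged into one kernel-verified Lean document; each statement's English description precedes it below -/
import Mathlib

section
/- If K is a field containing an algebraically closed subfield, then K̃ equals the prime field of K. -/
/-- A finite set `A` is adequate for `r`: it contains `r`, and every map `f`
preserving `1` (when `1 ∈ A`) and preserving sums/products lying in `A` fixes `r`. -/
def Adequate {K : Type*} [Field K] (A : Finset K) (r : K) : Prop :=
  r ∈ A ∧ ∀ f : K → K,
    ((1 : K) ∈ A → f 1 = 1) →
    (∀ a b : K, a ∈ A → b ∈ A → a + b ∈ A → f (a + b) = f a + f b) →
    (∀ a b : K, a ∈ A → b ∈ A → a * b ∈ A → f (a * b) = f a * f b) →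
    f r = r

theorem Adequate.mono {K : Type*} [Field K] {A B : Finset K} {r : K}
    (h : Adequate A r) (hAB : A ⊆ B) : Adequate B r :=
  ⟨hAB h.1, fun f h1 hadd hmul => h.2 f (fun h => h1 (hAB h))
    (fun a b ha hb hab => hadd a b (hAB ha) (hAB hb) (hAB hab))
    (fun a b ha hb hab => hmul a b (hAB ha) (hAB hb) (hAB hab))⟩

theorem adequate_zero {K : Type*} [Field K] : Adequate ({0} : Finset K) 0 := by
  refine ⟨by simp, fun f _ hadd _ => ?_⟩
  simpa using hadd 0 0 (by simp) (by simp) (by simp)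

theorem adequate_one {K : Type*} [Field K] : Adequate ({1} : Finset K) 1 :=
  ⟨by simp, fun f h1 _ _ => h1 (by simp)⟩

open Classical in
/-- The elements admitting an adequate set form a subfield. -/
noncomputable def adequateSubfield (K : Type*) [Field K] : Subfield K where
  carrier := {r : K | ∃ A : Finset K, Adequate A r}
  zero_mem' := ⟨_, adequate_zero⟩
  one_mem' := ⟨_, adequate_one⟩
  add_mem' := by
    rintro a b ⟨A, hA⟩ ⟨B, hB⟩
    refine ⟨insert (a + b) (A ∪ B), by simp, fun f h1 hadd hmul => ?_⟩
    have ha := hA.mono (B := insert (a + b) (A ∪ B)) (by grind)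
    have hb := hB.mono (B := insert (a + b) (A ∪ B)) (by grind)
    rw [hadd a b ha.1 hb.1 (by simp), ha.2 f h1 hadd hmul, hb.2 f h1 hadd hmul]
  mul_mem' := by
    rintro a b ⟨A, hA⟩ ⟨B, hB⟩
    refine ⟨insert (a * b) (A ∪ B), by simp, fun f h1 hadd hmul => ?_⟩
    have ha := hA.mono (B := insert (a * b) (A ∪ B)) (by grind)
    have hb := hB.mono (B := insert (a * b) (A ∪ B)) (by grind)
    rw [hmul a b ha.1 hb.1 (by simp), ha.2 f h1 hadd hmul, hb.2 f h1 hadd hmul]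
  neg_mem' := by
    rintro a ⟨A, hA⟩
    refine ⟨insert (-a) (insert 0 A), by simp, fun f h1 hadd hmul => ?_⟩
    have ha := hA.mono (B := insert (-a) (insert 0 A)) (by grind)
    have h0 := (adequate_zero (K := K)).mono (B := insert (-a) (insert 0 A)) (by simp)
    have h := hadd a (-a) ha.1 (by simp) (by simp)
    rw [add_neg_cancel, h0.2 f h1 hadd hmul, ha.2 f h1 hadd hmul] at h
    exact eq_neg_of_add_eq_zero_right h.symm
  inv_mem' := by
    rintro a ⟨A, hA⟩
    rcases eq_or_ne a 0 with rfl | hne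
    · rw [inv_zero]
      exact ⟨_, adequate_zero⟩
    refine ⟨insert a⁻¹ (insert 1 A), by simp, fun f h1 hadd hmul => ?_⟩
    have ha := hA.mono (B := insert a⁻¹ (insert 1 A)) (by grind)
    have h := hmul a a⁻¹ ha.1 (by simp) (by simp [hne])
    rw [mul_inv_cancel₀ hne, h1 (by simp), ha.2 f h1 hadd hmul] at h
    exact eq_inv_of_mul_eq_one_right h.symm

/-- Over a perfect field, an element of an algebraic extension whose image under every embedding
into an algebraically closed field is the same lies in the base field. -/
theorem mem_range_algebraMap_of_forall_algHom_eq {k F L : Type*} [Field k] [PerfectField k]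
    [Field F] [Algebra k F] [Algebra.IsAlgebraic k F] [Field L] [IsAlgClosed L] [Algebra k L]
    (x : F) (y : L) (h : ∀ φ : F →ₐ[k] L, φ x = y) : x ∈ (algebraMap k F).range := by
  have hx : IsIntegral k x := Algebra.IsIntegral.isIntegral x
  have hroots : (minpoly k x).rootSet L ⊆ {y} := by
    rw [← Algebra.IsAlgebraic.range_eval_eq_rootSet_minpoly L x]
    rintro _ ⟨φ, rfl⟩
    exact h φ
  have hcard := Polynomial.card_rootSet_eq_natDegree (K := L)
    (PerfectField.separable_of_irreducible (minpoly.irreducible hx))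
    (IsAlgClosed.splits _)
  refine minpoly.mem_range_of_degree_eq_one k x ?_
  refine (Polynomial.degree_eq_iff_natDegree_eq (minpoly.ne_zero hx)).2 ?_
  refine le_antisymm ?_ (minpoly.natDegree_pos hx)
  rw [← hcard, ← Nat.card_eq_fintype_card, Nat.card_coe_set_eq]
  exact (Set.ncard_le_ncard hroots (Set.finite_singleton y)).trans (Set.ncard_singleton y).le

/-- An element with an adequate set lies in the image of any perfect field `k` over which `K` is
an algebra, provided that `K` contains an algebraically closed extension of `k`. -/
theorem Adequate.exists_algebraMap_eq (k L : Type*) {K : Type*} [Field k] [PerfectField k]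
    [Field L] [IsAlgClosed L] [Field K] [Algebra k L] [Algebra k K] [Algebra L K]
    {A : Finset K} {r : K} (h : Adequate A r) :
    ∃ c : k, algebraMap L K (algebraMap k L c) = r := by
  classical
  let R := Algebra.adjoin k (A : Set K)
  have hA : ∀ a ∈ A, a ∈ R := fun a ha => Algebra.subset_adjoin ha
  obtain ⟨m, hm⟩ := Ideal.exists_maximal R
  let _ : Field (R ⧸ m) := Ideal.Quotient.field m
  have : Algebra.FiniteType k R := (Subalgebra.fg_iff_finiteType _).1 (Subalgebra.fg_adjoin_finset A)
  have : Algebra.FiniteType k (R ⧸ m) := inferInstance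
  have : Module.Finite k (R ⧸ m) := finite_of_finite_type_of_isJacobsonRing k (R ⧸ m)
  have : Algebra.IsAlgebraic k (R ⧸ m) := Algebra.IsAlgebraic.of_finite k (R ⧸ m)
  have : Module.IsTorsionFree k (R ⧸ m) := by
    have : FaithfulSMul k (R ⧸ m) :=
      (faithfulSMul_iff_algebraMap_injective k (R ⧸ m)).2 (algebraMap k (R ⧸ m)).injective
    exact Module.IsTorsionFree.trans_faithfulSMul k (R ⧸ m) (R ⧸ m)
  have key : ∀ φ : (R ⧸ m) →ₐ[k] L,
      algebraMap L K (φ (Ideal.Quotient.mk m ⟨r, hA r h.1⟩)) = r := by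
    intro φ
    let ψ : R →+* K := ((algebraMap L K).comp φ.toRingHom).comp (Ideal.Quotient.mk m)
    let f : K → K := fun a => if ha : a ∈ R then ψ ⟨a, ha⟩ else 0
    have hf : ∀ a : R, f a = ψ a := fun a => dif_pos a.2
    have hfix := h.2 f (fun _ => (hf 1).trans (map_one ψ)) ?_ ?_
    · exact (hf ⟨r, hA r h.1⟩).symm.trans hfix
    · intro a b ha hb _
      have := hf (⟨a, hA a ha⟩ + ⟨b, hA b hb⟩)
      rwa [map_add, ← hf, ← hf] at this
    · intro a b ha hb _
      have := hf (⟨a, hA a ha⟩ * ⟨b, hA b hb⟩)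
      rwa [map_mul, ← hf, ← hf] at this
  let φ₀ : (R ⧸ m) →ₐ[k] L := IsAlgClosed.lift
  obtain ⟨c, hc⟩ := mem_range_algebraMap_of_forall_algHom_eq (k := k) (L := L)
    (Ideal.Quotient.mk m ⟨r, hA r h.1⟩) (φ₀ (Ideal.Quotient.mk m ⟨r, hA r h.1⟩))
    (fun φ => (algebraMap L K).injective ((key φ).trans (key φ₀).symm))
  refine ⟨c, ?_⟩
  rw [← key φ₀, ← hc, AlgHom.commutes]

/-- If K contains an algebraically closed subfield, then K̃ is the prime field of K. -/
theorem tilde_eq_prime_field_of_algClosed_subfield {K : Type*} [Field K]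
    (L : Subfield K) (hL : IsAlgClosed L) :
    {r : K | ∃ A : Finset K, Adequate A r} = ((⊥ : Subfield K) : Set K) := by
  refine Set.Subset.antisymm ?_ (bot_le : ⊥ ≤ adequateSubfield K)
  rintro r ⟨A, hA⟩
  obtain ⟨p, hp⟩ := CharP.exists K
  rcases CharP.char_is_prime_or_zero K p with hprime | rfl
  · have : Fact p.Prime := ⟨hprime⟩
    have : CharP L p := (algebraMap L K).charP (algebraMap L K).injective p
    let _ : Algebra (ZMod p) L := ZMod.algebra L p
    let _ : Algebra (ZMod p) K := ZMod.algebra K p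
    obtain ⟨c, rfl⟩ := hA.exists_algebraMap_eq (ZMod p) L
    obtain ⟨n, rfl⟩ := ZMod.natCast_zmod_surjective c
    rw [map_natCast, map_natCast]
    exact natCast_mem _ n
  · have : CharZero K := CharP.charP_to_charZero K
    have : CharZero L := (algebraMap L K).charZero
    obtain ⟨c, rfl⟩ := hA.exists_algebraMap_eq ℚ L
    rw [eq_ratCast, map_ratCast]
    exact SubfieldClass.ratCast_mem _ c
end

section
/- If r ∈ ℚ_p admits a finite adequate set, then r is algebraic over ℚ; hence (ℚ_p)~ = { x ∈ ℚ_p : x algebraic over ℚ }. -/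
section

open Filter Topology Polynomial

/-- A simple root of a polynomial over a complete field persists under small perturbations of the
coefficients. -/
theorem Polynomial.eventually_exists_eval_eq_zero {K ι : Type*} [NontriviallyNormedField K]
    [CompleteSpace K] {l : Filter ι} {m : K[X]} {x : K} (hm : m.eval x = 0)
    (hm' : m.derivative.eval x ≠ 0) {g : ι → K[X]} (hdeg : ∀ i, (g i).natDegree ≤ m.natDegree)
    (hlim : ∀ k, Tendsto (fun i => (g i).coeff k) l (𝓝 (m.coeff k))) :
    ∀ᶠ i in l, ∃ y, (g i).eval y = 0 := by
  let d := m.natDegree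
  let G : (Fin (d + 1) → K) × K → K := fun u => ∑ k, u.1 k * u.2 ^ (k : ℕ)
  have hG (q : K[X]) (hq : q.natDegree ≤ d) (y : K) : G (fun k => q.coeff k, y) = q.eval y := by
    rw [eval_eq_sum_range' (Nat.lt_succ_of_le hq), Finset.sum_range]
  let u : (Fin (d + 1) → K) × K := (fun k => m.coeff k, x)
  have hfst (k : Fin (d + 1)) :
      HasStrictFDerivAt (𝕜 := K) (fun u : (Fin (d + 1) → K) × K => u.1 k)
        ((ContinuousLinearMap.proj k).comp (ContinuousLinearMap.fst K _ _)) u :=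
    ((ContinuousLinearMap.proj (R := K) (φ := fun _ : Fin (d + 1) => K) k).comp
      (ContinuousLinearMap.fst K _ K)).hasStrictFDerivAt
  have hder := HasStrictFDerivAt.fun_sum (u := Finset.univ) fun k _ =>
    (hfst k).mul ((hasStrictFDerivAt_snd (𝕜 := K) (p := u)).pow (k : ℕ))
  have key := hder.eventually_apply_implicitFunctionOfProdDomain (by
    refine ⟨ContinuousLinearEquiv.unitsEquivAut K (Units.mk0 _ hm'), ?_⟩
    ext
    simp [derivative_eval, sum_over_range, Finset.sum_range, u]
    exact Finset.sum_congr rfl fun k _ => by ring)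
  have ht : Tendsto (fun i => fun k : Fin (d + 1) => (g i).coeff k) l (𝓝 u.1) :=
    tendsto_pi_nhds.2 fun k => hlim k
  filter_upwards [ht.eventually key] with i hi
  refine ⟨_, ((hG _ (hdeg i) _).symm.trans hi).trans ((hG m le_rfl x).trans hm)⟩

/-- A homomorphism `σ : F →+* K` extends to `L` as soon as the image under `σ` of the minimal
polynomial of a primitive element of `L / F` has a root in `K`. -/
theorem PowerBasis.exists_ringHom_extension {F L K : Type*} [Field F] [Field L] [Field K]
    [Algebra F L] (pb : PowerBasis F L) (σ : F →+* K) {y : K}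
    (hy : ((minpoly F pb.gen).map σ).eval y = 0) :
    ∃ ψ : L →+* K, ∀ x, ψ (algebraMap F L x) = σ x := by
  let := σ.toAlgebra
  exact ⟨(pb.lift y (by rwa [aeval_def, eval₂_eq_eval_map])).toRingHom,
    fun x => (pb.lift y _).commutes x⟩

/-- Homomorphisms `F →+* K` converging pointwise to the structure map eventually extend to any
finite extension of `F` inside the complete field `K`. -/
theorem IntermediateField.eventually_exists_ringHom_extension {F K ι : Type*} [Field F] [CharZero F]
    [NontriviallyNormedField K] [CompleteSpace K] [Algebra F K] (L : IntermediateField F K)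
    [FiniteDimensional F L] {l : Filter ι} {σ : ι → F →+* K}
    (hσ : ∀ x, Tendsto (fun i => σ i x) l (𝓝 (algebraMap F K x))) :
    ∀ᶠ i in l, ∃ ψ : L →+* K, ∀ x, ψ (algebraMap F L x) = σ i x := by
  let pb := Field.powerBasisOfFiniteOfSeparable F L
  let m := minpoly F pb.gen
  have hsep : m.Separable := (minpoly.irreducible pb.isIntegral_gen).separable
  have hm : (m.map (algebraMap F K)).eval (pb.gen : K) = 0 := by
    have := congrArg (algebraMap L K) (minpoly.aeval F pb.gen)
    rwa [← aeval_algebraMap_apply, map_zero, aeval_def, eval₂_eq_eval_map] at this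
  have hm' : (m.map (algebraMap F K)).derivative.eval (pb.gen : K) ≠ 0 := by
    rw [derivative_map, ← eval₂_eq_eval_map]
    exact hsep.eval₂_derivative_ne_zero _ ((eval₂_eq_eval_map _).trans hm)
  have key := eventually_exists_eval_eq_zero (l := l) hm
    hm'
    (g := fun i => m.map (σ i)) (fun i => by simp) (fun k => by simpa using hσ (m.coeff k))
  filter_upwards [key] with i ⟨y, hy⟩
  exact pb.exists_ringHom_extension (σ i) hy

/-- Pointwise convergence of injective homomorphisms passes to the fraction field. -/
theorem tendsto_fractionRing_lift {R K ι : Type*} [CommRing R] [IsDomain R] [NormedField K]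
    [Algebra R K] [FaithfulSMul R K] [Algebra (FractionRing R) K]
    [IsScalarTower R (FractionRing R) K] {l : Filter ι} {σ : ι → R →+* K}
    (hinj : ∀ i, Function.Injective (σ i))
    (hσ : ∀ x, Tendsto (fun i => σ i x) l (𝓝 (algebraMap R K x))) (x : FractionRing R) :
    Tendsto (fun i => IsFractionRing.lift (hinj i) x) l (𝓝 (algebraMap (FractionRing R) K x)) := by
  obtain ⟨a, b, hb, rfl⟩ := IsFractionRing.div_surjective (A := R) x
  simp only [map_div₀, IsFractionRing.lift_algebraMap, ← IsScalarTower.algebraMap_apply]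
  refine (hσ a).div (hσ b) ?_
  simpa using nonZeroDivisors.ne_zero hb

/-- Translating all members of an algebraically independent set by rationals tending to `0` gives
injective homomorphisms converging pointwise to the inclusion. -/
theorem AlgebraicIndependent.exists_translation {K : Type*} [NormedField K] [Algebra ℚ K]
    {s : Set K} (hs : AlgebraicIndependent ℚ ((↑) : s → K)) {c : ℕ → ℚ}
    (hc : Tendsto (fun n => algebraMap ℚ K (c n)) atTop (𝓝 0)) :
    ∃ σ : ℕ → Algebra.adjoin ℚ (Set.range ((↑) : s → K)) →+* K,
      (∀ n, Function.Injective (σ n)) ∧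
      (∀ x, Tendsto (fun n => σ n x) atTop (𝓝 (x : K))) ∧
      ∀ n (x : Algebra.adjoin ℚ (Set.range ((↑) : s → K))), (x : K) ∈ s →
        σ n x = x + algebraMap ℚ K (c n) := by
  let τ (n : ℕ) : MvPolynomial s ℚ →ₐ[ℚ] K :=
    MvPolynomial.aeval fun t => (t : K) + algebraMap ℚ K (c n)
  refine ⟨fun n => (τ n).toRingHom.comp hs.repr.toRingHom, fun n => ?_, fun x => ?_,
    fun n x hx => ?_⟩
  · let shift (c : ℚ) : MvPolynomial s ℚ →ₐ[ℚ] MvPolynomial s ℚ :=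
      MvPolynomial.aeval fun t => MvPolynomial.X t + MvPolynomial.C c
    have hshift : (shift (-c n)).comp (shift (c n)) = AlgHom.id ℚ _ := by
      ext t
      simp [shift]
    have hτ : τ n = (MvPolynomial.aeval ((↑) : s → K)).comp (shift (c n)) := by
      ext t
      simp [τ, shift]
    have hinj : Function.Injective (shift (c n)) :=
      Function.LeftInverse.injective (g := shift (-c n)) fun q => DFunLike.congr_fun hshift q
    have : Function.Injective (τ n) := by
      rw [hτ]
      exact (algebraicIndependent_iff_injective_aeval.1 hs).comp hinj
    exact this.comp hs.aevalEquiv.symm.injective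
  · have hcont := (MvPolynomial.continuous_eval
      ((hs.repr x).map (algebraMap ℚ K))).tendsto ((↑) : s → K)
    have hpt : Tendsto (fun (n : ℕ) (t : s) => (t : K) + algebraMap ℚ K (c n)) atTop
        (𝓝 ((↑) : s → K)) :=
      tendsto_pi_nhds.2 fun t => by simpa using hc.const_add (t : K)
    have := hcont.comp hpt
    rw [MvPolynomial.eval_map, ← MvPolynomial.aeval_def, hs.aeval_repr] at this
    refine this.congr fun n => ?_
    simp [τ, MvPolynomial.eval_map, MvPolynomial.aeval_def]
  · have : hs.repr x = MvPolynomial.X ⟨x, hx⟩ := by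
      apply (algebraicIndependent_iff_injective_aeval.1 hs)
      rw [hs.aeval_repr]; simp
    simp [this, τ]

/-- A transcendental element can be moved by an embedding of a subfield containing any prescribed
finite set. -/
theorem exists_ringHom_apply_ne_of_transcendental {K : Type*} [NontriviallyNormedField K]
    [CompleteSpace K] [Algebra ℚ K] {c : ℕ → ℚ} (hc0 : ∀ n, c n ≠ 0)
    (hc : Tendsto (fun n => algebraMap ℚ K (c n)) atTop (𝓝 0)) {r : K}
    (hr : Transcendental ℚ r) (A : Finset K) :
    ∃ (L : Subfield K) (ψ : L →+* K), (A : Set K) ⊆ L ∧ ∃ x : L, (x : K) = r ∧ ψ x ≠ r := by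
  obtain ⟨s, hrs, hs⟩ := exists_isTranscendenceBasis_superset (R := ℚ) (s := {r})
    ((algebraicIndependent_singleton_iff (⟨r, rfl⟩ : ({r} : Set K))).2 hr)
  obtain ⟨σ, hinj, hlim, htrans⟩ := hs.1.exists_translation hc
  have halg := hs.isAlgebraic
  generalize hR : Algebra.adjoin ℚ (Set.range ((↑) : s → K)) = R at *
  have hrR : r ∈ R := hR ▸ Algebra.subset_adjoin ⟨⟨r, hrs rfl⟩, rfl⟩
  let := FractionRing.liftAlgebra R K
  have : CharZero R := charZero_of_injective_algebraMap (algebraMap ℚ R).injective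
  have : CharZero (FractionRing R) :=
    charZero_of_injective_algebraMap (IsFractionRing.injective R _)
  have : Algebra.IsAlgebraic (FractionRing R) K := IsFractionRing.comap_isAlgebraic_iff.1 halg
  let L := IntermediateField.adjoin (FractionRing R) (A : Set K)
  have : FiniteDimensional (FractionRing R) L :=
    IntermediateField.finiteDimensional_adjoin fun x _ =>
      (Algebra.IsAlgebraic.isAlgebraic x).isIntegral
  obtain ⟨n, ψ, hψ⟩ := (L.eventually_exists_ringHom_extension
    (tendsto_fractionRing_lift hinj hlim)).exists
  refine ⟨L.toSubfield, ψ, IntermediateField.subset_adjoin _ _,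
    algebraMap (FractionRing R) L (algebraMap R (FractionRing R) ⟨r, hrR⟩), ?_, ?_⟩
  · exact (IsScalarTower.algebraMap_apply R (FractionRing R) K ⟨r, hrR⟩).symm
  · rw [hψ, IsFractionRing.lift_algebraMap, htrans n ⟨r, hrR⟩ (hrs rfl)]
    exact mt add_eq_left.1 ((_root_.map_ne_zero _).2 (hc0 n))

theorem Adequate.apply_eq_of_ringHom {K : Type*} [Field K] {A : Finset K} {r : K}
    (h : Adequate A r) {L : Subfield K} (hA : (A : Set K) ⊆ L) (ψ : L →+* K) (x : L)
    (hx : (x : K) = r) : ψ x = r := by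
  classical
  let f : K → K := fun y => if h : y ∈ L then ψ ⟨y, h⟩ else 0
  have hf (y : K) (hy : y ∈ L) : f y = ψ ⟨y, hy⟩ := dif_pos hy
  subst hx
  refine (hf x x.2).symm.trans (h.2 f (fun h1 => ?_) (fun a b ha hb _ => ?_)
    fun a b ha hb _ => ?_)
  · rw [hf 1 L.one_mem]
    exact map_one ψ
  · rw [hf a (hA ha), hf b (hA hb), hf _ (L.add_mem (hA ha) (hA hb)), ← map_add]
    rfl
  · rw [hf a (hA ha), hf b (hA hb), hf _ (L.mul_mem (hA ha) (hA hb)), ← map_mul]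
    rfl

theorem Adequate.isAlgebraic {p : ℕ} [Fact p.Prime] {A : Finset ℚ_[p]} {r : ℚ_[p]}
    (h : Adequate A r) : IsAlgebraic ℚ r := by
  by_contra hr
  have hp : (p : ℚ) ≠ 0 := mod_cast (Fact.out : p.Prime).ne_zero
  obtain ⟨L, ψ, hA, x, hx, hne⟩ := exists_ringHom_apply_ne_of_transcendental
    (c := fun n => (p : ℚ) ^ n) (fun n => pow_ne_zero n hp)
    (by simpa using tendsto_pow_atTop_nhds_zero_of_norm_lt_one (Padic.norm_p_lt_one (p := p))) hr A
  exact hne (h.apply_eq_of_ringHom hA ψ x hx)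

/-- If no finite set is adequate for `r`, the witnesses assemble into a ring homomorphism from `K`
to the ring of germs of functions `Finset K → K` at infinity that moves `r`. -/
theorem exists_ringHom_germ_of_forall_not_adequate {K : Type*} [Field K] {r : K}
    (h : ∀ A : Finset K, ¬ Adequate A r) :
    ∃ (f : Finset K → K → K) (Φ : K →+* (atTop : Filter (Finset K)).Germ K),
      (∀ x, Φ x = ((fun A => f A x : Finset K → K) : (atTop : Filter (Finset K)).Germ K)) ∧
      ∀ᶠ A in atTop, f A r ≠ r := by
  have key (A : Finset K) : ∃ f : K → K, ((1 : K) ∈ A → f 1 = 1) ∧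
      (∀ a b : K, a ∈ A → b ∈ A → a + b ∈ A → f (a + b) = f a + f b) ∧
      (∀ a b : K, a ∈ A → b ∈ A → a * b ∈ A → f (a * b) = f a * f b) ∧ (r ∈ A → f r ≠ r) := by
    by_cases hr : r ∈ A
    · have := h A
      simp only [Adequate, hr, true_and] at this
      push Not at this
      obtain ⟨f, h1, h2, h3, h4⟩ := this
      exact ⟨f, h1, h2, h3, fun _ => h4⟩
    · exact ⟨id, by simp [hr]⟩
  choose f h1 hadd hmul hne using key
  have hmem (x : K) : ∀ᶠ A : Finset K in atTop, x ∈ A :=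
    (eventually_ge_atTop {x}).mono fun A hA => hA (Finset.mem_singleton_self x)
  have hadd' (x y : K) : ∀ᶠ A : Finset K in atTop, f A (x + y) = f A x + f A y := by
    filter_upwards [hmem x, hmem y, hmem (x + y)] with A using hadd A x y
  refine ⟨f, ⟨⟨⟨fun x => ((fun A => f A x : Finset K → K) : Germ atTop K), ?_⟩, ?_⟩, ?_, ?_⟩,
    fun x => rfl, (hmem r).mono hne⟩
  · exact Germ.coe_eq.2 ((hmem 1).mono h1)
  · intro x y
    refine Germ.coe_eq.2 ?_
    filter_upwards [hmem x, hmem y, hmem (x * y)] with A using hmul A x y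
  · exact Germ.coe_eq.2 ((hadd' 0 0).mono fun A hA => by simpa using hA)
  · exact fun x y => Germ.coe_eq.2 (hadd' x y)

theorem Filter.Germ.eventually_aeval_eq_zero {K ι : Type*} [Field K] {l : Filter ι}
    {x : ι → K} {P : ℤ[X]} (h : aeval (x : l.Germ K) P = 0) :
    ∀ᶠ i in l, aeval (x i) P = 0 := by
  have := (aeval_algHom_apply (coeRingHom (R := K) l).toIntAlgHom x P).symm.trans h
  refine (Germ.coe_eq.1 this).mono fun i hi => ?_
  exact (aeval_algHom_apply (Pi.evalRingHom (fun _ => K) i).toIntAlgHom x P).trans hi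

/-- The ring of integers of `ℚ_[p]` is existentially definable. -/
theorem Padic.norm_le_one_iff_exists_sq {p : ℕ} [Fact p.Prime] {y : ℚ_[p]} :
    ‖y‖ ≤ 1 ↔ ∃ z, z ^ 2 = 1 + (p : ℚ_[p]) ^ 3 * y ^ 4 := by
  have hp : (p : ℚ_[p]) ≠ 0 := mod_cast (Fact.out : p.Prime).ne_zero
  have hp1 : (1 : ℝ) < p := mod_cast (Fact.out : p.Prime).one_lt
  constructor
  · intro hy
    let w : ℤ_[p] := ⟨y, hy⟩
    obtain ⟨c, hc⟩ : ∃ c : ℤ_[p], c = 1 + (p : ℤ_[p]) ^ 3 * w ^ 4 := ⟨_, rfl⟩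
    have hc1 : ‖1 - c‖ ≤ ((p : ℝ) ^ 3)⁻¹ := by
      rw [hc, sub_add_cancel_left, norm_neg, norm_mul, norm_pow, norm_pow, PadicInt.norm_p, inv_pow]
      exact mul_le_of_le_one_right (by positivity)
        (pow_le_one₀ (norm_nonneg _) (PadicInt.norm_le_one w))
    have h2 : ((p : ℝ) ^ 3)⁻¹ < ‖(2 : ℤ_[p])‖ ^ 2 := by
      obtain rfl | hp2 := eq_or_ne p 2
      · have : ‖(2 : ℤ_[2])‖ = 2⁻¹ := by simpa using PadicInt.norm_p (p := 2)
        rw [this]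
        norm_num
      · have : ‖((2 : ℕ) : ℤ_[p])‖ = 1 := PadicInt.norm_natCast_eq_one_iff.2
          ((Nat.coprime_primes Fact.out Nat.prime_two).2 hp2)
        rw [Nat.cast_ofNat] at this
        rw [this, one_pow]
        exact inv_lt_one_of_one_lt₀ (one_lt_pow₀ hp1 three_ne_zero)
    let F : ℤ_[p][X] := X ^ 2 - C c
    obtain ⟨z, hz, -⟩ := hensels_lemma (F := F) (a := (1 : ℤ_[p])) (by
      simpa [F, one_add_one_eq_two] using hc1.trans_lt h2)
    refine ⟨z, ?_⟩
    have : z ^ 2 = 1 + (p : ℤ_[p]) ^ 3 * w ^ 4 := by simpa [F, sub_eq_zero, hc] using hz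
    have hw : (w : ℚ_[p]) = y := rfl
    rw [← hw]
    exact_mod_cast congrArg ((↑) : ℤ_[p] → ℚ_[p]) this
  · rintro ⟨z, hz⟩
    by_contra! hy
    have hy0 : y ≠ 0 := by rintro rfl; norm_num at hy
    have hnorm : ‖(p : ℚ_[p]) ^ 3 * y ^ 4‖ = (p : ℝ) ^ (-(3 + 4 * y.valuation)) := by
      rw [Padic.norm_eq_zpow_neg_valuation (by positivity), 
        Padic.valuation_mul (by positivity) (by positivity)]
      simp [Padic.valuation_pow]
    have hv : y.valuation < 0 := by
      rw [Padic.norm_eq_zpow_neg_valuation hy0, one_lt_zpow_iff_right₀ hp1] at hy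
      linarith
    have hgt : 1 < ‖(p : ℚ_[p]) ^ 3 * y ^ 4‖ := by
      rw [hnorm, one_lt_zpow_iff_right₀ hp1]
      linarith
    have hz2 : ‖z ^ 2‖ = (p : ℝ) ^ (-(3 + 4 * y.valuation)) := by
      rw [hz, ← hnorm, Padic.add_eq_max_of_ne (by simpa using hgt.ne)]
      simpa using hgt.le
    have hz0 : z ≠ 0 := by
      rintro rfl
      rw [← hnorm, zero_pow two_ne_zero, norm_zero] at hz2
      exact absurd hgt (by simp [← hz2])
    rw [Padic.norm_eq_zpow_neg_valuation (by positivity), Padic.valuation_pow] at hz2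
    have := zpow_right_injective₀ (by linarith) hp1.ne' hz2
    push_cast at this
    omega

/-- Each `r` is isolated from a finite set by a ball with rational centre, written with integer
coefficients. -/
theorem Padic.exists_int_isolating {p : ℕ} [Fact p.Prime] (r : ℚ_[p]) (S : Finset ℚ_[p]) :
    ∃ (a b : ℤ) (n : ℕ), (∃ y : ℚ_[p], ‖y‖ ≤ 1 ∧ b * r = a + b * p ^ n * y) ∧
      ∀ s ∈ S, (∃ y : ℚ_[p], ‖y‖ ≤ 1 ∧ b * s = a + b * p ^ n * y) → s = r := by
  have hp : (p : ℚ_[p]) ≠ 0 := mod_cast (Fact.out : p.Prime).ne_zero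
  have hlim : Tendsto (fun n : ℕ => ‖(p : ℚ_[p]) ^ n‖) atTop (𝓝 0) := by
    simpa using (tendsto_pow_atTop_nhds_zero_of_norm_lt_one (Padic.norm_p_lt_one (p := p))).norm
  have hsep : ∀ᶠ n in atTop, ∀ s ∈ S, s ≠ r → ‖(p : ℚ_[p]) ^ n‖ < ‖s - r‖ := by
    refine (Finset.eventually_all S).2 fun s _ => ?_
    by_cases hs : s = r
    · simp [hs]
    · exact (hlim.eventually_lt_const (norm_pos_iff.2 (sub_ne_zero.2 hs))).mono fun n hn _ => hn
  obtain ⟨n, hn⟩ := hsep.exists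
  have hpn : 0 < ‖(p : ℚ_[p]) ^ n‖ := norm_pos_iff.2 (pow_ne_zero n hp)
  obtain ⟨q, hq⟩ := Padic.rat_dense p r hpn
  have hb : (q.den : ℚ_[p]) ≠ 0 := mod_cast q.den_nz
  have hqab : (q : ℚ_[p]) * q.den = q.num := mod_cast q.mul_den_eq_num
  refine ⟨q.num, q.den, n, ⟨(r - q) / p ^ n, ?_, ?_⟩, ?_⟩
  · rw [norm_div, div_le_one hpn]
    exact hq.le
  · rw [← hqab]
    field_simp
    push_cast
    ring
  · rintro s hs ⟨y, hy, hsy⟩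
    by_contra hne
    have hsq : s - q = p ^ n * y := by
      apply mul_left_cancel₀ hb
      push_cast at hsy
      linear_combination hsy - hqab
    have h1 : ‖s - q‖ ≤ ‖(p : ℚ_[p]) ^ n‖ := by
      rw [hsq, norm_mul]
      exact mul_le_of_le_one_right (norm_nonneg _) hy
    have h2 : ‖s - r‖ ≤ ‖(p : ℚ_[p]) ^ n‖ := by
      rw [show s - r = (s - q) + -(r - q) by ring]
      refine (Padic.nonarchimedean _ _).trans (max_le h1 ?_)
      rw [norm_neg]
      exact hq.le
    exact (hn s hs hne).not_ge h2

theorem Padic.exists_adequate_of_isAlgebraic {p : ℕ} [Fact p.Prime] {r : ℚ_[p]}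
    (hr : IsAlgebraic ℚ r) : ∃ A : Finset ℚ_[p], Adequate A r := by
  classical
  by_contra! hA
  obtain ⟨P, hP0, hP⟩ := (IsFractionRing.isAlgebraic_iff ℤ ℚ ℚ_[p]).2 hr
  obtain ⟨a, b, n, ⟨y, hy, hry⟩, hiso⟩ :=
    Padic.exists_int_isolating r (P.aroots ℚ_[p]).toFinset
  obtain ⟨z, hz⟩ := Padic.norm_le_one_iff_exists_sq.1 hy
  obtain ⟨f, Φ, hΦ, hne⟩ := exists_ringHom_germ_of_forall_not_adequate hA
  have hroot : ∀ᶠ A in atTop, aeval (f A r) P = 0 := by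
    apply Germ.eventually_aeval_eq_zero
    rw [← hΦ]
    exact (aeval_algHom_apply Φ.toIntAlgHom r P).trans (by simp [hP])
  have hball : ∀ᶠ A in atTop, b * f A r = a + b * p ^ n * f A y := by
    have := congrArg Φ hry
    simp only [map_add, map_mul, map_pow, map_intCast, map_natCast] at this
    simp only [hΦ] at this
    exact Germ.coe_eq.1 this
  have hsq : ∀ᶠ A in atTop, f A z ^ 2 = 1 + (p : ℚ_[p]) ^ 3 * f A y ^ 4 := by
    have := congrArg Φ hz
    simp only [map_add, map_mul, map_pow, map_one, map_natCast] at this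
    simp only [hΦ] at this
    exact Germ.coe_eq.1 this
  obtain ⟨A, hne, hroot, hball, hsq⟩ := (hne.and (hroot.and (hball.and hsq))).exists
  refine hne (hiso _ ?_ ⟨f A y, Padic.norm_le_one_iff_exists_sq.2 ⟨_, hsq⟩, hball⟩)
  rw [Multiset.mem_toFinset, mem_aroots]
  exact ⟨hP0, hroot⟩

end

/-- If r ∈ ℚ_p admits a finite adequate set then r is algebraic over ℚ; hence
(ℚ_p)~ is the set of p-adic numbers algebraic over ℚ. -/
theorem tilde_padic_eq_algebraic (p : ℕ) [Fact p.Prime] :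
    (∀ r : ℚ_[p], (∃ A : Finset ℚ_[p], Adequate A r) → IsAlgebraic ℚ r) ∧
    {r : ℚ_[p] | ∃ A : Finset ℚ_[p], Adequate A r} =
      {r : ℚ_[p] | IsAlgebraic ℚ r} := by
  have h (r : ℚ_[p]) : (∃ A : Finset ℚ_[p], Adequate A r) → IsAlgebraic ℚ r :=
    fun ⟨_, hA⟩ => hA.isAlgebraic
  exact ⟨h, Set.ext fun r => ⟨h r, Padic.exists_adequate_of_isAlgebraic⟩⟩
end
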